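/- Let p be a prime number, let e ≥ 1 be a natural number, and let f ∈ F_p[X] be a nonzero polynomial. Then the degree of gcd(X^{p^e} − X, f), computed in F_p[X], equals the number of distinct roots of the image of f in F_{p^e}[X] (i.e., of f mapped along the canonical embedding F_p → F_{p^e}) that lie in the field F_{p^e} with p^e elements. -/

import Mathlib

open Polynomial

open scoped Classical in
/-- For a prime `p`, `e ≥ 1` and a nonzero polynomial `f` over `F_p`, the
degree of `gcd (X^(p^e) - X) f` (computed in `F_p[X]`) equals the number of
distinct roots, lying in the field with `p^e` elements, of the image of `f`
in `F_{p^e}[X]`. -/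
theorem natDegree_gcd_Xpe_sub_X_eq_card_roots_ext
    (p : ℕ) [Fact p.Prime] (e : ℕ) (he : 1 ≤ e)
    (f : Polynomial (ZMod p)) (hf : f ≠ 0) :
    (EuclideanDomain.gcd (X ^ p ^ e - X) f).natDegree =
      (f.map (algebraMap (ZMod p) (GaloisField p e))).roots.toFinset.card := by
  have he' : e ≠ 0 := by omega
  have hp : 1 < p := (Fact.out : p.Prime).one_lt
  set φ := algebraMap (ZMod p) (GaloisField p e) with hφ
  set P : (ZMod p)[X] := X ^ p ^ e - X with hP
  set g := EuclideanDomain.gcd P f with hg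
  have hP0 : P ≠ 0 := FiniteField.X_pow_card_pow_sub_X_ne_zero _ he' hp
  have hgP : g ∣ P := EuclideanDomain.gcd_dvd_left _ _
  have hgf : g ∣ f := EuclideanDomain.gcd_dvd_right _ _
  have hbez : g = P * EuclideanDomain.gcdA P f + f * EuclideanDomain.gcdB P f :=
    EuclideanDomain.gcd_eq_gcd_ab _ _
  have hg0 : g ≠ 0 := ne_zero_of_dvd_ne_zero hf hgf
  have hPs : (P.map φ).Splits := by
    have := FiniteField.isSplittingField_of_nat_card_eq p e
      (K := GaloisField p e) (GaloisField.card p e he')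
    exact IsSplittingField.splits (GaloisField p e) P
  have hsep : P.Separable := galois_poly_separable p _ (dvd_pow_self p he')
  have hgs : (g.map φ).Splits :=
    hPs.of_dvd ((Polynomial.map_ne_zero_iff φ.injective).2 hP0) (Polynomial.map_dvd φ hgP)
  have hgsep : (g.map φ).Separable := (hsep.of_dvd hgP).map
  have hroot : ∀ x : GaloisField p e, (P.map φ).eval x = 0 := by
    intro x
    have : Fintype (GaloisField p e) := Fintype.ofFinite _
    have hc : Fintype.card (GaloisField p e) = p ^ e := by
      rw [← Nat.card_eq_fintype_card, GaloisField.card p e he']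
    have := FiniteField.pow_card x
    rw [hc] at this
    simp [hP, this]
  rw [← natDegree_map φ, hgs.natDegree_eq_card_roots,
    ← Multiset.toFinset_card_of_nodup (nodup_roots hgsep)]
  congr 1
  ext x
  rw [Multiset.mem_toFinset, Multiset.mem_toFinset,
    mem_roots ((Polynomial.map_ne_zero_iff φ.injective).2 hg0),
    mem_roots ((Polynomial.map_ne_zero_iff φ.injective).2 hf)]
  constructor
  · intro h
    exact h.dvd (Polynomial.map_dvd φ hgf)
  · intro h
    rw [IsRoot.def] at h ⊢
    rw [hbez, Polynomial.map_add, Polynomial.map_mul, Polynomial.map_mul, eval_add, eval_mul,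
      eval_mul, hroot, h, zero_mul, zero_mul, add_zero]
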